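/- Every tree belonging to the family 𝒯 admits no (1,2,2)-packing coloring. -/

import Mathlib

/-- `c` is an `s`-packing coloring of the simple graph `G`: for each color `i`, any two
distinct vertices with color `i` are at graph distance strictly greater than `s i`
(vertices in different connected components trivially satisfy this). -/
def IsPackingColoring {V : Type*} (G : SimpleGraph V) {k : ℕ} (s : Fin k → ℕ)
    (c : V → Fin k) : Prop :=
  ∀ u v : V, u ≠ v → c u = c v → G.Reachable u v → s (c u) < G.dist u v

/-- The tree `T₀`: a path `a₁ a₂ a₃ a₄ a₅` (vertices `0,…,4`) with one pendant leaf
attached to each of `a₂, a₃, a₄` (leaves `5, 6, 7`). -/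
def treeT0 : SimpleGraph (Fin 8) :=
  SimpleGraph.fromRel (fun u v =>
    (u, v) ∈ ([(0,1),(1,2),(2,3),(3,4),(1,5),(2,6),(3,7)] : List (Fin 8 × Fin 8)))

/-- The tree `T₁`: a path `b₁ b₂ … b₈` (vertices `0,…,7`) with one pendant leaf
attached to each of `b₂, b₃, b₆, b₇` (leaves `8, 9, 10, 11`). -/
def treeT1 : SimpleGraph (Fin 12) :=
  SimpleGraph.fromRel (fun u v =>
    (u, v) ∈ ([(0,1),(1,2),(2,3),(3,4),(4,5),(5,6),(6,7),
               (1,8),(2,9),(5,10),(6,11)] : List (Fin 12 × Fin 12)))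

/-- The tree obtained from `T` by removing the edge `uv`, adding four new vertices
`u₁ = n, u₂ = n+1, u₃ = n+2, w = n+3` and adding the edges
`u u₁`, `u₁ u₂`, `u₂ u₃`, `u₃ v` and `u₂ w`. -/
def extendTree {n : ℕ} (T : SimpleGraph (Fin n)) (u v : Fin n) :
    SimpleGraph (Fin (n + 4)) :=
  SimpleGraph.fromRel (fun a b =>
    (∃ a' b' : Fin n, a = Fin.castAdd 4 a' ∧ b = Fin.castAdd 4 b' ∧ T.Adj a' b' ∧
      ¬(a' = u ∧ b' = v) ∧ ¬(a' = v ∧ b' = u)) ∨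
    (a = Fin.castAdd 4 u ∧ b = Fin.natAdd n 0) ∨
    (a = Fin.natAdd n 0 ∧ b = Fin.natAdd n 1) ∨
    (a = Fin.natAdd n 1 ∧ b = Fin.natAdd n 2) ∨
    (a = Fin.natAdd n 2 ∧ b = Fin.castAdd 4 v) ∨
    (a = Fin.natAdd n 1 ∧ b = Fin.natAdd n 3))

/-- The family `𝒯` (up to isomorphism, represented on the vertex types `Fin n`):
it contains `T₀` and `T₁`, and is closed under the extension operation applied to a
pair of adjacent vertices that both have degree `2`. -/
inductive InFamilyT : ∀ n : ℕ, SimpleGraph (Fin n) → Prop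
  | base0 : InFamilyT 8 treeT0
  | base1 : InFamilyT 12 treeT1
  | extend {n : ℕ} (T : SimpleGraph (Fin n)) (u v : Fin n) :
      InFamilyT n T → T.Adj u v →
      (T.neighborSet u).ncard = 2 → (T.neighborSet v).ncard = 2 →
      InFamilyT (n + 4) (extendTree T u v)

/-- The graph obtained from `T` by deleting every edge that joins two vertices of degree `2`. -/
def thinEdgeDeletion {V : Type*} (T : SimpleGraph V) : SimpleGraph V where
  Adj a b := T.Adj a b ∧ ¬((T.neighborSet a).ncard = 2 ∧ (T.neighborSet b).ncard = 2)
  symm := ⟨fun _ _ h => ⟨h.1.symm, fun h' => h.2 ⟨h'.2, h'.1⟩⟩⟩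
  loopless := ⟨fun _ h => h.1.ne rfl⟩

/-- The local form of a `(1,2,2)`-packing coloring: it is proper, and two distinct vertices with a
common neighbor may share only the color `0`. -/
structure IsLocalColoring {V : Type*} (G : SimpleGraph V) (c : V → Fin 3) : Prop where
  ne_of_adj : ∀ {a b}, G.Adj a b → c a ≠ c b
  eq_zero_of_adj_adj : ∀ {a b d}, G.Adj a b → G.Adj b d → a ≠ d → c a = c d → c a = 0

section LocalColoring

variable {V W : Type*} {G : SimpleGraph V} {H : SimpleGraph W}

theorem IsPackingColoring.isLocalColoring {c : V → Fin 3}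
    (hc : IsPackingColoring G ![1, 2, 2] c) : IsLocalColoring G c where
  ne_of_adj {a b} h e := by
    have h1 := hc a b h.ne e h.reachable
    rw [SimpleGraph.dist_eq_one_iff_adj.2 h] at h1
    generalize c a = i at h1
    fin_cases i <;> simp at h1
  eq_zero_of_adj_adj {a b d} h h' hne e := by
    have h1 := hc a d hne e (h.reachable.trans h'.reachable)
    have h2 : G.dist a d ≤ 2 := SimpleGraph.dist_le (.cons h (.cons h' .nil))
    generalize c a = i at h1
    fin_cases i <;> simp at h1 ⊢ <;> omega

theorem IsLocalColoring.comp {c : W → Fin 3} (hc : IsLocalColoring H c) {f : V → W}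
    (hf : f.Injective) (h : ∀ {a b}, G.Adj a b → H.Adj (f a) (f b)) :
    IsLocalColoring G (c ∘ f) where
  ne_of_adj hab := hc.ne_of_adj (h hab)
  eq_zero_of_adj_adj hab hbd hne e := hc.eq_zero_of_adj_adj (h hab) (h hbd) (hf.ne hne) e

theorem IsLocalColoring.ne_zero_of_three_adj {c : V → Fin 3} (hc : IsLocalColoring G c)
    {v x y z : V} (hx : G.Adj v x) (hy : G.Adj v y) (hz : G.Adj v z)
    (hxy : x ≠ y) (hxz : x ≠ z) (hyz : y ≠ z) : c v ≠ 0 := by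
  have h1 := hc.ne_of_adj hx
  have h2 := hc.ne_of_adj hy
  have h3 := hc.ne_of_adj hz
  have h4 := hc.eq_zero_of_adj_adj hx.symm hy hxy
  have h5 := hc.eq_zero_of_adj_adj hx.symm hz hxz
  have h6 := hc.eq_zero_of_adj_adj hy.symm hz hyz
  omega

theorem ncard_neighborSet_ne_two {v x y z : V} (hx : G.Adj v x) (hy : G.Adj v y) (hz : G.Adj v z)
    (hxy : x ≠ y) (hxz : x ≠ z) (hyz : y ≠ z) : (G.neighborSet v).ncard ≠ 2 := by
  intro h
  obtain ⟨p, q, -, e⟩ := Set.ncard_eq_two.1 h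
  have key : ∀ w, G.Adj v w → w = p ∨ w = q := fun w hw => by
    have : w ∈ G.neighborSet v := hw
    simpa [e] using this
  grind

theorem thinEdgeDeletion_adj_of_three_adj {v x y z w : V} (hx : G.Adj v x) (hy : G.Adj v y)
    (hz : G.Adj v z) (hxy : x ≠ y) (hxz : x ≠ z) (hyz : y ≠ z) (hw : G.Adj v w) :
    (thinEdgeDeletion G).Adj v w :=
  ⟨hw, fun h => ncard_neighborSet_ne_two hx hy hz hxy hxz hyz h.1⟩

end LocalColoring

/-- Every local coloring of `thinEdgeDeletion T` gives color `0` to both ends of some deleted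
edge. -/
def HasZeroThinEdge {V : Type*} (T : SimpleGraph V) : Prop :=
  ∀ c : V → Fin 3, IsLocalColoring (thinEdgeDeletion T) c →
    ∃ a b, T.Adj a b ∧ (T.neighborSet a).ncard = 2 ∧ (T.neighborSet b).ncard = 2 ∧
      c a = 0 ∧ c b = 0

theorem hasZeroThinEdge_treeT0 : HasZeroThinEdge treeT0 := by
  intro c hc
  have e1 : ∀ w, treeT0.Adj 1 w → (thinEdgeDeletion treeT0).Adj 1 w := fun w hw =>
    thinEdgeDeletion_adj_of_three_adj (x := 0) (y := 2) (z := 5) (by simp [treeT0])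
      (by simp [treeT0]) (by simp [treeT0]) (by decide) (by decide) (by decide) hw
  have e2 : ∀ w, treeT0.Adj 2 w → (thinEdgeDeletion treeT0).Adj 2 w := fun w hw =>
    thinEdgeDeletion_adj_of_three_adj (x := 1) (y := 3) (z := 6) (by simp [treeT0])
      (by simp [treeT0]) (by simp [treeT0]) (by decide) (by decide) (by decide) hw
  have e3 : ∀ w, treeT0.Adj 3 w → (thinEdgeDeletion treeT0).Adj 3 w := fun w hw =>
    thinEdgeDeletion_adj_of_three_adj (x := 2) (y := 4) (z := 7) (by simp [treeT0])
      (by simp [treeT0]) (by simp [treeT0]) (by decide) (by decide) (by decide) hw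
  have n1 := hc.ne_zero_of_three_adj (e1 0 (by simp [treeT0])) (e1 2 (by simp [treeT0]))
    (e1 5 (by simp [treeT0])) (by decide) (by decide) (by decide)
  have n2 := hc.ne_zero_of_three_adj (e2 1 (by simp [treeT0])) (e2 3 (by simp [treeT0]))
    (e2 6 (by simp [treeT0])) (by decide) (by decide) (by decide)
  have n3 := hc.ne_zero_of_three_adj (e3 2 (by simp [treeT0])) (e3 4 (by simp [treeT0]))
    (e3 7 (by simp [treeT0])) (by decide) (by decide) (by decide)
  have a12 := e1 2 (by simp [treeT0])
  have a23 := e2 3 (by simp [treeT0])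
  have h1 := hc.ne_of_adj a12
  have h2 := hc.ne_of_adj a23
  have h3 := hc.eq_zero_of_adj_adj a12 a23 (by decide)
  omega

/-- In a local coloring, a vertex following two adjacent vertices of nonzero color has color `0`. -/
theorem IsLocalColoring.eq_zero_of_ne_zero {V : Type*} {G : SimpleGraph V} {c : V → Fin 3}
    (hc : IsLocalColoring G c) {a b d : V} (hab : G.Adj a b) (hbd : G.Adj b d) (hne : a ≠ d)
    (ha : c a ≠ 0) (hb : c b ≠ 0) : c d = 0 := by
  have h1 := hc.ne_of_adj hab
  have h2 := hc.ne_of_adj hbd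
  have h3 := hc.eq_zero_of_adj_adj hab hbd hne
  omega

theorem ncard_neighborSet_eq_two {V : Type*} {G : SimpleGraph V} {v x y : V} (hxy : x ≠ y)
    (h : ∀ w, G.Adj v w ↔ w = x ∨ w = y) : (G.neighborSet v).ncard = 2 :=
  Set.ncard_eq_two.2 ⟨x, y, hxy, by ext w; simp [h]⟩

theorem hasZeroThinEdge_treeT1 : HasZeroThinEdge treeT1 := by
  intro c hc
  have e1 : ∀ w, treeT1.Adj 1 w → (thinEdgeDeletion treeT1).Adj 1 w := fun w hw =>
    thinEdgeDeletion_adj_of_three_adj (x := 0) (y := 2) (z := 8) (by simp [treeT1])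
      (by simp [treeT1]) (by simp [treeT1]) (by decide) (by decide) (by decide) hw
  have e2 : ∀ w, treeT1.Adj 2 w → (thinEdgeDeletion treeT1).Adj 2 w := fun w hw =>
    thinEdgeDeletion_adj_of_three_adj (x := 1) (y := 3) (z := 9) (by simp [treeT1])
      (by simp [treeT1]) (by simp [treeT1]) (by decide) (by decide) (by decide) hw
  have e5 : ∀ w, treeT1.Adj 5 w → (thinEdgeDeletion treeT1).Adj 5 w := fun w hw =>
    thinEdgeDeletion_adj_of_three_adj (x := 4) (y := 6) (z := 10) (by simp [treeT1])
      (by simp [treeT1]) (by simp [treeT1]) (by decide) (by decide) (by decide) hw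
  have e6 : ∀ w, treeT1.Adj 6 w → (thinEdgeDeletion treeT1).Adj 6 w := fun w hw =>
    thinEdgeDeletion_adj_of_three_adj (x := 5) (y := 7) (z := 11) (by simp [treeT1])
      (by simp [treeT1]) (by simp [treeT1]) (by decide) (by decide) (by decide) hw
  have n1 := hc.ne_zero_of_three_adj (e1 0 (by simp [treeT1])) (e1 2 (by simp [treeT1]))
    (e1 8 (by simp [treeT1])) (by decide) (by decide) (by decide)
  have n2 := hc.ne_zero_of_three_adj (e2 1 (by simp [treeT1])) (e2 3 (by simp [treeT1]))
    (e2 9 (by simp [treeT1])) (by decide) (by decide) (by decide)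
  have n5 := hc.ne_zero_of_three_adj (e5 4 (by simp [treeT1])) (e5 6 (by simp [treeT1]))
    (e5 10 (by simp [treeT1])) (by decide) (by decide) (by decide)
  have n6 := hc.ne_zero_of_three_adj (e6 5 (by simp [treeT1])) (e6 7 (by simp [treeT1]))
    (e6 11 (by simp [treeT1])) (by decide) (by decide) (by decide)
  refine ⟨3, 4, by simp [treeT1], ncard_neighborSet_eq_two (x := 2) (y := 4) (by decide) ?_,
    ncard_neighborSet_eq_two (x := 3) (y := 5) (by decide) ?_,
    hc.eq_zero_of_ne_zero (e1 2 (by simp [treeT1])) (e2 3 (by simp [treeT1])) (by decide) n1 n2,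
    hc.eq_zero_of_ne_zero (e6 5 (by simp [treeT1])) (e5 4 (by simp [treeT1])) (by decide) n6 n5⟩
  · intro w
    fin_cases w <;> simp [treeT1]
  · intro w
    fin_cases w <;> simp [treeT1]

section Extension

variable {n : ℕ} {T : SimpleGraph (Fin n)} {u v : Fin n}

theorem castAdd_ne_natAdd (a : Fin n) (i : Fin 4) : Fin.castAdd 4 a ≠ Fin.natAdd n i := by
  simp [Fin.ext_iff]
  omega

theorem extendTree_adj_castAdd_castAdd {a b : Fin n} :
    (extendTree T u v).Adj (Fin.castAdd 4 a) (Fin.castAdd 4 b) ↔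
      T.Adj a b ∧ ¬(a = u ∧ b = v) ∧ ¬(a = v ∧ b = u) := by
  simp only [extendTree, SimpleGraph.fromRel_adj, castAdd_ne_natAdd,
    (Fin.castAdd_injective n 4).eq_iff]
  have := T.adj_comm a b
  have : T.Adj a b → a ≠ b := SimpleGraph.Adj.ne
  grind

theorem extendTree_adj_castAdd_natAdd {a : Fin n} {i : Fin 4} :
    (extendTree T u v).Adj (Fin.castAdd 4 a) (Fin.natAdd n i) ↔
      (a = u ∧ i = 0) ∨ (a = v ∧ i = 2) := by
  have := castAdd_ne_natAdd a i
  simp [extendTree, castAdd_ne_natAdd, (castAdd_ne_natAdd _ _).symm, Fin.natAdd_inj]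
  grind

theorem extendTree_adj_natAdd_castAdd {a : Fin n} {i : Fin 4} :
    (extendTree T u v).Adj (Fin.natAdd n i) (Fin.castAdd 4 a) ↔
      (a = u ∧ i = 0) ∨ (a = v ∧ i = 2) := by
  rw [SimpleGraph.adj_comm, extendTree_adj_castAdd_natAdd]

theorem extendTree_adj_natAdd_natAdd {i j : Fin 4} :
    (extendTree T u v).Adj (Fin.natAdd n i) (Fin.natAdd n j) ↔
      (i = 1 ∧ j ≠ 1) ∨ (j = 1 ∧ i ≠ 1) := by
  simp [extendTree, (castAdd_ne_natAdd _ _).symm, Fin.natAdd_inj]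
  revert i j
  decide

theorem ncard_neighborSet_extendTree_castAdd (huv : T.Adj u v) (a : Fin n) :
    ((extendTree T u v).neighborSet (Fin.castAdd 4 a)).ncard = (T.neighborSet a).ncard := by
  classical
  have hne := huv.ne
  let f : Fin n → Fin (n + 4) := fun b =>
    if a = u ∧ b = v then Fin.natAdd n 0 else if a = v ∧ b = u then Fin.natAdd n 2
    else Fin.castAdd 4 b
  have hf : f.Injective := by
    intro b b' h
    have h1 := castAdd_ne_natAdd b
    have h2 := castAdd_ne_natAdd b'
    have h3 := @Fin.castAdd_injective n 4 b b'
    simp only [f] at h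
    grind
  rw [← Set.ncard_image_of_injective _ hf]
  congr 1
  ext x
  simp only [SimpleGraph.mem_neighborSet, Set.mem_image]
  induction x using Fin.addCases with
  | left b =>
    rw [extendTree_adj_castAdd_castAdd]
    constructor
    · rintro ⟨h, h1, h2⟩
      exact ⟨b, h, by simp only [f]; rw [if_neg h1, if_neg h2]⟩
    · rintro ⟨b', h, h'⟩
      have h1 := castAdd_ne_natAdd b
      have h3 := @Fin.castAdd_injective n 4 b' b
      simp only [f] at h'
      grind
  | right i =>
    rw [extendTree_adj_castAdd_natAdd]
    constructor
    · rintro (⟨rfl, rfl⟩ | ⟨rfl, rfl⟩)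
      · exact ⟨v, huv, by simp [f]⟩
      · exact ⟨u, huv.symm, by simp [f, hne.symm]⟩
    · rintro ⟨b, h, h'⟩
      have h1 := castAdd_ne_natAdd b i
      have h3 : ∀ j, Fin.natAdd n j = Fin.natAdd n i → j = i := fun j => (Fin.natAdd_inj n).1
      simp only [f] at h'
      grind

theorem hasZeroThinEdge_extendTree (hT : HasZeroThinEdge T) (huv : T.Adj u v)
    (hu : (T.neighborSet u).ncard = 2) (hv : (T.neighborSet v).ncard = 2) :
    HasZeroThinEdge (extendTree T u v) := by
  intro c hc
  have hdeg := ncard_neighborSet_extendTree_castAdd huv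
  have hsub : ∀ {a b}, (thinEdgeDeletion T).Adj a b →
      (thinEdgeDeletion (extendTree T u v)).Adj (Fin.castAdd 4 a) (Fin.castAdd 4 b) := by
    rintro a b ⟨h, h'⟩
    refine ⟨extendTree_adj_castAdd_castAdd.2 ⟨h, ?_, ?_⟩, by rwa [hdeg, hdeg]⟩
    · rintro ⟨rfl, rfl⟩
      exact h' ⟨hu, hv⟩
    · rintro ⟨rfl, rfl⟩
      exact h' ⟨hv, hu⟩
  have hmid : ∀ {i : Fin 4}, i ≠ 1 → (thinEdgeDeletion (extendTree T u v)).Adj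
      (Fin.natAdd n 1) (Fin.natAdd n i) := fun {i} hi =>
    thinEdgeDeletion_adj_of_three_adj (x := Fin.natAdd n 0) (y := Fin.natAdd n 2)
      (z := Fin.natAdd n 3) (extendTree_adj_natAdd_natAdd.2 (by decide))
      (extendTree_adj_natAdd_natAdd.2 (by decide)) (extendTree_adj_natAdd_natAdd.2 (by decide))
      (by simp [Fin.natAdd_inj]) (by simp [Fin.natAdd_inj]) (by simp [Fin.natAdd_inj])
      (extendTree_adj_natAdd_natAdd.2 (by simp [hi]))
  have d0 : ((extendTree T u v).neighborSet (Fin.natAdd n 0)).ncard = 2 := by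
    refine ncard_neighborSet_eq_two (castAdd_ne_natAdd u 1) fun w => ?_
    induction w using Fin.addCases with
    | left b => simp [extendTree_adj_natAdd_castAdd, castAdd_ne_natAdd]
    | right i => simp [extendTree_adj_natAdd_natAdd, (castAdd_ne_natAdd _ _).symm, Fin.natAdd_inj]
  have d2 : ((extendTree T u v).neighborSet (Fin.natAdd n 2)).ncard = 2 := by
    refine ncard_neighborSet_eq_two (castAdd_ne_natAdd v 1) fun w => ?_
    induction w using Fin.addCases with
    | left b => simp [extendTree_adj_natAdd_castAdd, castAdd_ne_natAdd]
    | right i => simp [extendTree_adj_natAdd_natAdd, (castAdd_ne_natAdd _ _).symm, Fin.natAdd_inj]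
  have hzero : c (Fin.castAdd 4 u) = 0 → c (Fin.castAdd 4 v) = 0 →
      ∃ a b, (extendTree T u v).Adj a b ∧
        ((extendTree T u v).neighborSet a).ncard = 2 ∧
        ((extendTree T u v).neighborSet b).ncard = 2 ∧ c a = 0 ∧ c b = 0 := by
    intro cu cv
    have h1 := hc.ne_zero_of_three_adj (hmid (i := 0) (by decide)) (hmid (i := 2) (by decide))
      (hmid (i := 3) (by decide)) (by simp [Fin.natAdd_inj]) (by simp [Fin.natAdd_inj])
      (by simp [Fin.natAdd_inj])
    by_cases h0 : c (Fin.natAdd n 0) = 0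
    · exact ⟨_, _, extendTree_adj_castAdd_natAdd.2 (.inl ⟨rfl, rfl⟩), by rwa [hdeg], d0, cu, h0⟩
    · exact ⟨_, _, extendTree_adj_castAdd_natAdd.2 (.inr ⟨rfl, rfl⟩), by rwa [hdeg], d2, cv,
        hc.eq_zero_of_ne_zero (hmid (i := 0) (by decide)).symm (hmid (i := 2) (by decide))
          (by simp [Fin.natAdd_inj]) h0 h1⟩
  obtain ⟨a, b, hab, ha, hb, ca, cb⟩ := hT _ (hc.comp (Fin.castAdd_injective n 4) hsub)
  by_cases h1 : a = u ∧ b = v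
  · obtain ⟨rfl, rfl⟩ := h1
    exact hzero ca cb
  by_cases h2 : a = v ∧ b = u
  · obtain ⟨rfl, rfl⟩ := h2
    exact hzero cb ca
  exact ⟨_, _, extendTree_adj_castAdd_castAdd.2 ⟨hab, h1, h2⟩, by rwa [hdeg], by rwa [hdeg],
    ca, cb⟩

end Extension

theorem InFamilyT.hasZeroThinEdge {n : ℕ} {T : SimpleGraph (Fin n)} (h : InFamilyT n T) :
    HasZeroThinEdge T := by
  induction h with
  | base0 => exact hasZeroThinEdge_treeT0
  | base1 => exact hasZeroThinEdge_treeT1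
  | extend T u v _ huv hu hv ih => exact hasZeroThinEdge_extendTree ih huv hu hv

/-- Every tree belonging to the family `𝒯` (i.e. every graph isomorphic to a member
of the family) admits no `(1,2,2)`-packing coloring. -/
theorem familyT_not_122_colorable {V : Type*} [Fintype V] (G : SimpleGraph V)
    (hG : ∃ (n : ℕ) (T : SimpleGraph (Fin n)), InFamilyT n T ∧ Nonempty (G ≃g T)) :
    ¬ ∃ c : V → Fin 3, IsPackingColoring G ![1, 2, 2] c := by
  rintro ⟨c, hc⟩
  obtain ⟨n, T, hT, ⟨e⟩⟩ := hG
  have hc' := hc.isLocalColoring.comp (G := T) e.symm.injective fun h => e.symm.map_adj_iff.2 h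
  obtain ⟨a, b, hab, -, -, ha, hb⟩ := hT.hasZeroThinEdge _
    (hc'.comp (f := id) Function.injective_id fun h => h.1)
  exact hc'.ne_of_adj hab (ha.trans hb.symm)
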